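/- arXiv:2006.07942 — 11 statements merged into one kernel-verified Lean document; each statement's English description precedes it below -/
import Mathlib

section
/- Upper limit of enforceable security policies for a binary state space (Proposition 2, N = 2): let |Θ| = M and |A| = K, and for p ∈ [0,1] and type θ let U_θ(a,p) = p·v(θ,a,1) + (1−p)·v(θ,a,2). Then the number of profiles σ : Θ → A for which there exists p ∈ [0,1] such that, for every θ ∈ Θ, U_θ(σ(θ),p) > U_θ(a,p) for all a ≠ σ(θ), is at most M·K(K−1)/2 + 1. -/
open Classical in
/-- Triples `(θ, a, b)` such that the affine map `p ↦ U_θ(b,p)` is strictly steeper than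
`p ↦ U_θ(a,p)`. -/
noncomputable def steeperTriples {Θ A : Type*} [Fintype Θ] [Fintype A] (v1 v2 : Θ → A → ℝ) :
    Finset (Θ × A × A) :=
  {x | v1 x.1 x.2.1 - v2 x.1 x.2.1 < v1 x.1 x.2.2 - v2 x.1 x.2.2}

open Classical in
/-- The steeper triples `(θ, a, b)` for which `b` has already overtaken `a` at belief `p`. -/
noncomputable def overtakenTriples {Θ A : Type*} [Fintype Θ] [Fintype A] (v1 v2 : Θ → A → ℝ)
    (p : ℝ) : Finset (Θ × A × A) :=
  {x ∈ steeperTriples v1 v2 | p * v1 x.1 x.2.1 + (1 - p) * v2 x.1 x.2.1 <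
    p * v1 x.1 x.2.2 + (1 - p) * v2 x.1 x.2.2}

theorem card_steeperTriples_le {Θ A : Type*} [Fintype Θ] [Fintype A] (v1 v2 : Θ → A → ℝ) :
    (steeperTriples v1 v2).card ≤
      Fintype.card Θ * (Fintype.card A * (Fintype.card A - 1)) / 2 := by
  classical
  have hinj : Function.Injective (fun x : Θ × A × A => (x.1, x.2.2, x.2.1)) := by
    rintro ⟨θ, a, b⟩ ⟨θ', a', b'⟩ h
    simp only [Prod.mk.injEq] at h ⊢
    tauto
  have hdisj : Disjoint (steeperTriples v1 v2)
      ((steeperTriples v1 v2).image (fun x => (x.1, x.2.2, x.2.1))) := by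
    rw [Finset.disjoint_left]
    rintro ⟨θ, a, b⟩ h h'
    obtain ⟨⟨θ', a', b'⟩, hy, he⟩ := Finset.mem_image.mp h'
    simp only [Prod.mk.injEq] at he
    obtain ⟨rfl, rfl, rfl⟩ := he
    simp only [steeperTriples, Finset.mem_filter, Finset.mem_univ, true_and] at h hy
    exact lt_asymm h hy
  have hsub : steeperTriples v1 v2 ∪
      (steeperTriples v1 v2).image (fun x => (x.1, x.2.2, x.2.1)) ⊆
      (Finset.univ : Finset Θ) ×ˢ (Finset.univ : Finset A).offDiag := by
    rintro ⟨θ, a, b⟩ h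
    simp only [Finset.mem_product, Finset.mem_offDiag, Finset.mem_univ, true_and]
    rintro rfl
    rcases Finset.mem_union.mp h with h | h
    · simp [steeperTriples] at h
    · obtain ⟨⟨θ', a', b'⟩, hy, he⟩ := Finset.mem_image.mp h
      simp only [Prod.mk.injEq] at he
      obtain ⟨rfl, rfl, rfl⟩ := he
      simp [steeperTriples] at hy
  have hcard := Finset.card_le_card hsub
  rw [Finset.card_union_of_disjoint hdisj, Finset.card_image_of_injective _ hinj,
    Finset.card_product, Finset.offDiag_card, Finset.card_univ, Finset.card_univ,
    ← Nat.mul_sub_one] at hcard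
  omega

theorem overtakenTriples_mono {Θ A : Type*} [Fintype Θ] [Fintype A] (v1 v2 : Θ → A → ℝ) :
    Monotone (overtakenTriples v1 v2) := by
  rintro p q hpq ⟨θ, a, b⟩ h
  simp only [overtakenTriples, steeperTriples, Finset.mem_filter, Finset.mem_univ,
    true_and] at h ⊢
  exact ⟨h.1, by nlinarith [h.1, h.2]⟩

/-- Different maximizing profiles at increasing beliefs force a new overtaking. -/
theorem card_overtakenTriples_lt {Θ A : Type*} [Fintype Θ] [Fintype A] (v1 v2 : Θ → A → ℝ)
    {σ τ : Θ → A} (hne : σ ≠ τ) {p q : ℝ} (hpq : p ≤ q)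
    (hσ : ∀ (θ : Θ) (a : A), a ≠ σ θ →
      p * v1 θ a + (1 - p) * v2 θ a < p * v1 θ (σ θ) + (1 - p) * v2 θ (σ θ))
    (hτ : ∀ (θ : Θ) (a : A), a ≠ τ θ →
      q * v1 θ a + (1 - q) * v2 θ a < q * v1 θ (τ θ) + (1 - q) * v2 θ (τ θ)) :
    (overtakenTriples v1 v2 p).card < (overtakenTriples v1 v2 q).card := by
  obtain ⟨θ, hθ⟩ := Function.ne_iff.mp hne
  have h1 := hσ θ (τ θ) hθ.symm
  have h2 := hτ θ (σ θ) hθ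
  apply Finset.card_lt_card
  refine (Finset.ssubset_iff_of_subset (overtakenTriples_mono v1 v2 hpq)).mpr
    ⟨(θ, σ θ, τ θ), ?_, ?_⟩
  · simp only [overtakenTriples, steeperTriples, Finset.mem_filter, Finset.mem_univ, true_and]
    refine ⟨?_, h2⟩
    by_contra! hs
    nlinarith
  · simp only [overtakenTriples, Finset.mem_filter, not_and, not_lt]
    exact fun _ => h1.le

/-- Proposition 2, N = 2: with binary states, the number of
profiles `σ : Θ → A` that are strictly elicitable at some belief `p ∈ [0,1]`
is at most `M·K(K−1)/2 + 1`, where `M = |Θ|` and `K = |A|`. -/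
theorem upper_limit_enforceable_policies_binary_state
    {Θ A : Type*} [Fintype Θ] [Fintype A] [Nonempty Θ] [Nonempty A]
    (v1 v2 : Θ → A → ℝ) :
    Set.ncard {σ : Θ → A | ∃ p ∈ Set.Icc (0 : ℝ) 1,
        ∀ (θ : Θ) (a : A), a ≠ σ θ →
          p * v1 θ a + (1 - p) * v2 θ a < p * v1 θ (σ θ) + (1 - p) * v2 θ (σ θ)}
      ≤ Fintype.card Θ * (Fintype.card A * (Fintype.card A - 1)) / 2 + 1 := by
  set S := {σ : Θ → A | ∃ p ∈ Set.Icc (0 : ℝ) 1, ∀ (θ : Θ) (a : A), a ≠ σ θ →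
    p * v1 θ a + (1 - p) * v2 θ a < p * v1 θ (σ θ) + (1 - p) * v2 θ (σ θ)}
  have hex : ∀ σ : Θ → A, σ ∈ S → ∃ p : ℝ, ∀ (θ : Θ) (a : A), a ≠ σ θ →
      p * v1 θ a + (1 - p) * v2 θ a < p * v1 θ (σ θ) + (1 - p) * v2 θ (σ θ) :=
    fun _ ⟨p, _, h⟩ => ⟨p, h⟩
  choose! p hp using hex
  have hinj : Set.InjOn (fun σ => (overtakenTriples v1 v2 (p σ)).card) S := by
    intro σ hσ τ hτ h
    by_contra hne
    rcases le_total (p σ) (p τ) with hle | hle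
    · exact (card_overtakenTriples_lt v1 v2 hne hle (hp σ hσ) (hp τ hτ)).ne h
    · exact (card_overtakenTriples_lt v1 v2 (Ne.symm hne) hle (hp τ hτ) (hp σ hσ)).ne' h
  refine (Set.ncard_le_ncard_of_injOn (t := (Finset.range
    (Fintype.card Θ * (Fintype.card A * (Fintype.card A - 1)) / 2 + 1) : Set ℕ)) _ ?_ hinj
    (Finset.finite_toSet _)).trans ?_
  · intro σ _
    have hsub : overtakenTriples v1 v2 (p σ) ⊆ steeperTriples v1 v2 := Finset.filter_subset _ _
    have := (Finset.card_le_card hsub).trans (card_steeperTriples_le v1 v2)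
    exact Finset.mem_coe.mpr (Finset.mem_range.mpr (Nat.lt_succ_of_le this))
  · rw [Set.ncard_coe_finset, Finset.card_range]
end

section
/- Complete misalignment under negative linear dependence (Proposition 3, ρ < 0 case): suppose v_l(x,a) = ρ·v_h(x,a) + t(x) for all x ∈ X and a ∈ A, with ρ < 0, and suppose |A| ≥ 2. Then for every belief p ∈ Δ(X) there exist distinct actions a_i ≠ a_j such that a_i maximizes a ↦ Σ_{x∈X} p(x) v_l(x,a) and a_j maximizes a ↦ Σ_x p(x) v_h(x,a); i.e., the two types are identifiable under every posterior belief. -/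
/-- On a finite type with at least two elements, a real function attains its minimum and its
maximum at two distinct points. -/
theorem exists_ne_isMin_isMax {A : Type*} [Finite A] [Nontrivial A] (u : A → ℝ) :
    ∃ m M : A, m ≠ M ∧ (∀ a, u m ≤ u a) ∧ ∀ a, u a ≤ u M := by
  obtain ⟨m, hm⟩ := Finite.exists_min u
  obtain ⟨M, hM⟩ := Finite.exists_max u
  by_cases h : m = M
  · subst h
    obtain ⟨b, hb⟩ := exists_ne m
    exact ⟨m, b, hb.symm, hm, fun a => (hM a).trans (hm b)⟩
  · exact ⟨m, M, h, hm, hM⟩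

/-- Proposition 3, ρ < 0 case: if `v_l = ρ·v_h + t(x)` with
`ρ < 0` and `|A| ≥ 2`, then at every belief there exist distinct actions that
are best responses of the two types respectively; i.e., the two types are
identifiable under every posterior belief. -/
theorem complete_misalignment_neg_linear_dependence
    {X A : Type*} [Fintype X] [Fintype A] [Nonempty X] [Nonempty A]
    (vl vh : X → A → ℝ) (ρ : ℝ) (t : X → ℝ)
    (hdep : ∀ x a, vl x a = ρ * vh x a + t x) (hρ : ρ < 0)
    (hA : 2 ≤ Fintype.card A)
    (p : X → ℝ) (hp : p ∈ stdSimplex ℝ X) :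
    ∃ ai aj : A, ai ≠ aj ∧
      (∀ a', ∑ x, p x * vl x a' ≤ ∑ x, p x * vl x ai) ∧
      (∀ a', ∑ x, p x * vh x a' ≤ ∑ x, p x * vh x aj) := by
  have : Nontrivial A := Fintype.one_lt_card_iff_nontrivial.mp hA
  have hsum : ∀ a, ∑ x, p x * vl x a = ρ * ∑ x, p x * vh x a + ∑ x, p x * t x := by
    intro a
    rw [Finset.mul_sum, ← Finset.sum_add_distrib]
    refine Finset.sum_congr rfl fun x _ => ?_
    rw [hdep]
    ring
  obtain ⟨m, M, hne, hm, hM⟩ := exists_ne_isMin_isMax fun a => ∑ x, p x * vh x a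
  refine ⟨m, M, hne, fun a => ?_, hM⟩
  rw [hsum, hsum]
  gcongr ?_ + _
  exact mul_le_mul_of_nonpos_left (hm a) hρ.le
end

section
/- Every Bayes-plausible distribution of posteriors is induced by a generator: let p0 ∈ Δ(X) with p0(x) > 0 for all x, let S be a finite set, let λ : S → [0,1] with Σ_{s∈S} λ_s = 1, and let q_s ∈ Δ(X) for each s ∈ S satisfy Σ_{s∈S} λ_s q_s(x) = p0(x) for every x (Bayesian plausibility). Define π(s|x) = λ_s q_s(x)/p0(x). Then: (i) π(·|x) is a probability distribution on S for every x; (ii) the induced marginal of each signal equals its weight, Σ_{x∈X} p0(x) π(s|x) = λ_s; and (iii) for every s with λ_s > 0 and every x, the Bayes posterior equals the prescribed posterior: p0(x)π(s|x)/Σ_{x'∈X} p0(x')π(s|x') = q_s(x). -/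
/-- every Bayes-plausible distribution of posteriors is induced
by a generator: with `π(s|x) = λ_s q_s(x)/p0(x)`, (i) `π(·|x)` is a probability
distribution on `S` for every `x`; (ii) `Σ_x p0(x) π(s|x) = λ_s`; and (iii) for
every `s` with `λ_s > 0`, the Bayes posterior of `π` equals `q_s`. -/
theorem bayes_plausible_posteriors_induced_by_generator
    {X S : Type*} [Fintype X] [Fintype S] [Nonempty X] [Nonempty S]
    (p0 : X → ℝ) (hp0 : p0 ∈ stdSimplex ℝ X) (hp0pos : ∀ x, 0 < p0 x)
    (lam : S → ℝ) (hlam0 : ∀ s, 0 ≤ lam s) (hlam1 : ∀ s, lam s ≤ 1)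
    (hlamsum : ∑ s, lam s = 1)
    (q : S → X → ℝ) (hq : ∀ s, q s ∈ stdSimplex ℝ X)
    (hBP : ∀ x, ∑ s, lam s * q s x = p0 x) :
    (∀ x, (∀ s, 0 ≤ lam s * q s x / p0 x) ∧ (∑ s, lam s * q s x / p0 x) = 1) ∧
    (∀ s, ∑ x, p0 x * (lam s * q s x / p0 x) = lam s) ∧
    (∀ s, 0 < lam s → ∀ x,
      p0 x * (lam s * q s x / p0 x) / (∑ x', p0 x' * (lam s * q s x' / p0 x'))
        = q s x) := by
  have joint : ∀ s x, p0 x * (lam s * q s x / p0 x) = lam s * q s x :=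
    fun s x => mul_div_cancel₀ _ (hp0pos x).ne'
  have marginal : ∀ s, ∑ x, p0 x * (lam s * q s x / p0 x) = lam s := fun s => by
    simp only [joint, ← Finset.mul_sum, (hq s).2, mul_one]
  refine ⟨fun x => ⟨fun s => ?_, ?_⟩, marginal, fun s hs x => ?_⟩
  · exact div_nonneg (mul_nonneg (hlam0 s) ((hq s).1 x)) (hp0pos x).le
  · rw [← Finset.sum_div, hBP, div_self (hp0pos x).ne']
  · rw [marginal, joint, mul_div_cancel_left₀ _ hs.ne']
end

section
/- The defender's prior utility is piecewise linear (Proposition 4): the function F : Δ(X) → ℝ defined by F(p) = max{L_σ(p) : σ : Θ → A is incentive-compatible at p} is well defined (the maximum is over a nonempty finite set for every p), and there exist finitely many pairwise disjoint convex subsets of Δ(X) whose union is Δ(X) such that the restriction of F to each of these convex sets is an affine function of p. -/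
/-- A convex set is partitioned into finitely many convex cells by the order that the values of
finitely many linear forms take at a point. -/
theorem exists_convex_partition_le_iff {E T : Type*} [AddCommGroup E] [Module ℝ E] [Finite T]
    (l : T → E →ₗ[ℝ] ℝ) {K : Set E} (hK : Convex ℝ K) :
    ∃ (n : ℕ) (C : Fin n → Set E),
      (∀ i, Convex ℝ (C i)) ∧ (∀ i j, i ≠ j → Disjoint (C i) (C j)) ∧ (⋃ i, C i) = K ∧
      ∀ i, ∀ p ∈ C i, ∀ q ∈ C i, ∀ s t, l s p ≤ l t p ↔ l s q ≤ l t q := by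
  obtain ⟨n, ⟨e⟩⟩ := Finite.exists_equiv_fin (Set (T × T))
  let pattern : E → Set (T × T) := fun p => {st | l st.1 p ≤ l st.2 p}
  refine ⟨n, fun i => K ∩ {p | pattern p = e.symm i}, fun i => hK.inter ?_, ?_, ?_, ?_⟩
  · have hcell : {p | pattern p = e.symm i} =
        ⋂ st : T × T, {p | l st.1 p ≤ l st.2 p ↔ st ∈ e.symm i} := by
      ext p
      simp [pattern, Set.ext_iff]
    rw [hcell]
    refine convex_iInter fun st => ?_
    by_cases h : st ∈ e.symm i
    · simpa [h] using convex_halfSpace_le (l st.1 - l st.2).isLinear 0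
    · simpa [h] using convex_halfSpace_gt (l st.1 - l st.2).isLinear 0
  · intro i j hij
    refine Set.disjoint_left.2 fun p hi hj => hij (e.symm.injective ?_)
    exact hi.2.symm.trans hj.2
  · ext p
    simp only [Set.mem_iUnion, Set.mem_inter_iff, Set.mem_ofPred_eq]
    exact ⟨fun ⟨_, h, _⟩ => h, fun h => ⟨e (pattern p), h, by simp⟩⟩
  · intro i p hp q hq s t
    exact Set.ext_iff.1 (hp.2.trans hq.2.symm) (s, t)


/-- Proposition 4: the defender's (defender-preferred) prior
utility `F(p) = max{L_σ(p) : σ incentive-compatible at p}` is well defined on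
the simplex (the maximum is over a nonempty finite set), and the simplex can be
partitioned into finitely many pairwise disjoint convex sets on each of which
`F` is affine. -/
theorem defender_prior_utility_piecewise_linear
    {X Θ A : Type*} [Fintype X] [Fintype Θ] [Fintype A]
    [Nonempty X] [Nonempty Θ] [Nonempty A]
    (vU vD : X → Θ → A → ℝ) (bD : X → Θ → ℝ)
    (hbD : ∀ x θ, 0 ≤ bD x θ) (hbDsum : ∀ x, ∑ θ, bD x θ = 1) :
    ∃ F : (X → ℝ) → ℝ,
      (∀ p ∈ stdSimplex ℝ X,
        (∃ σ : Θ → A,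
          (∀ (θ : Θ) (a : A), ∑ x, p x * vU x θ a ≤ ∑ x, p x * vU x θ (σ θ)) ∧
          F p = ∑ x, p x * ∑ θ, bD x θ * vD x θ (σ θ)) ∧
        (∀ σ : Θ → A,
          (∀ (θ : Θ) (a : A), ∑ x, p x * vU x θ a ≤ ∑ x, p x * vU x θ (σ θ)) →
          ∑ x, p x * ∑ θ, bD x θ * vD x θ (σ θ) ≤ F p)) ∧
      ∃ (n : ℕ) (C : Fin n → Set (X → ℝ)),
        (∀ i, Convex ℝ (C i)) ∧
        (∀ i j, i ≠ j → Disjoint (C i) (C j)) ∧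
        (⋃ i, C i) = stdSimplex ℝ X ∧
        (∀ i, ∃ (c : X → ℝ) (d : ℝ), ∀ p ∈ C i, F p = (∑ x, c x * p x) + d) := by
  let U : Θ → A → (X → ℝ) → ℝ := fun θ a p => ∑ x, p x * vU x θ a
  let L : (Θ → A) → (X → ℝ) → ℝ := fun σ p => ∑ x, p x * ∑ θ, bD x θ * vD x θ (σ θ)
  let IC : (X → ℝ) → Set (Θ → A) := fun p => {σ | ∀ θ a, U θ a p ≤ U θ (σ θ) p}
  have hopt : ∀ p, ∃ σ ∈ IC p, ∀ τ ∈ IC p, L τ p ≤ L σ p := by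
    intro p
    have hne : (IC p).Nonempty := by
      choose σ hσ using fun θ => Finite.exists_max fun a => U θ a p
      exact ⟨σ, hσ⟩
    exact Set.exists_max_image (IC p) (fun σ => L σ p) (Set.toFinite _) hne
  choose best hbest hmax using hopt
  let l : (Θ × A) ⊕ (Θ → A) → (X → ℝ) →ₗ[ℝ] ℝ :=
    Sum.elim (fun s => Fintype.linearCombination ℝ fun x => vU x s.1 s.2)
      (fun σ => Fintype.linearCombination ℝ fun x => ∑ θ, bD x θ * vD x θ (σ θ))
  refine ⟨fun p => L (best p) p, fun p _ => ⟨⟨best p, hbest p, rfl⟩, hmax p⟩, ?_⟩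
  obtain ⟨n, C, hconv, hdisj, hunion, hcell⟩ :=
    exists_convex_partition_le_iff l (convex_stdSimplex ℝ X)
  refine ⟨n, C, hconv, hdisj, hunion, fun i => ?_⟩
  rcases (C i).eq_empty_or_nonempty with hi | ⟨q, hq⟩
  · exact ⟨0, 0, by simp [hi]⟩
  refine ⟨fun x => ∑ θ, bD x θ * vD x θ (best q θ), 0, fun p hp => ?_⟩
  have hU : ∀ θ a b, U θ a p ≤ U θ b p ↔ U θ a q ≤ U θ b q := fun θ a b =>
    hcell i p hp q hq (.inl (θ, a)) (.inl (θ, b))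
  have hL : ∀ σ τ, L σ p ≤ L τ p ↔ L σ q ≤ L τ q := fun σ τ =>
    hcell i p hp q hq (.inr σ) (.inr τ)
  have hle : L (best p) p ≤ L (best q) p :=
    (hL _ _).2 (hmax q _ fun θ a => (hU _ _ _).1 (hbest p θ a))
  have hge : L (best q) p ≤ L (best p) p :=
    hmax p _ fun θ a => (hU _ _ _).2 (hbest q θ a)
  calc L (best p) p = L (best q) p := le_antisymm hle hge
    _ = _ := by simp only [L, add_zero, mul_comm (p _)]
end

section
/- Attainment and efficiency of the optimal generator (Proposition 5): fix a common prior p0 ∈ Δ(X) with p0(x) > 0 for all x. Then: (i) the supremum of the defender's expected posterior utility bar v_D(π) over all credible generators π is attained; (ii) the set of optimal credible generators is convex, hence it is either a singleton or infinite; and (iii) there exists an optimal credible generator π* whose total signal support has size at most N, i.e., |{s ∈ S : π*(s|x) > 0 for some x ∈ X}| ≤ N; in particular, for each state x, π*(·|x) assigns zero probability to at least K^M − N security policies. -/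
open Finset in
/-- A generator assigns to each state a probability distribution over security
policies `s : Θ → A`. -/
def IsGenerator12 {X Θ A : Type*} [Fintype X] [Fintype Θ] [Fintype A] [DecidableEq Θ]
    (π : (Θ → A) → X → ℝ) : Prop :=
  (∀ s x, 0 ≤ π s x) ∧ ∀ x, ∑ s, π s x = 1

open Finset in
/-- Credibility (the (IC) constraint) at common prior `p0`. -/
def IsCredible12 {X Θ A : Type*} [Fintype X] [Fintype Θ] [Fintype A] [DecidableEq Θ]
    (p0 : X → ℝ) (vU : X → Θ → A → ℝ) (π : (Θ → A) → X → ℝ) : Prop :=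
  ∀ (s : Θ → A) (θ : Θ) (a : A),
    0 ≤ ∑ x, p0 x * π s x * (vU x θ (s θ) - vU x θ a)

open Finset in
/-- The defender's expected posterior utility. -/
noncomputable def barvD12 {X Θ A : Type*} [Fintype X] [Fintype Θ] [Fintype A] [DecidableEq Θ]
    (p0 : X → ℝ) (bD : X → Θ → ℝ) (vD : X → Θ → A → ℝ)
    (π : (Θ → A) → X → ℝ) : ℝ :=
  ∑ x, p0 x * ∑ s, π s x * ∑ θ, bD x θ * vD x θ (s θ)

section OptimalGenerators

variable {X Θ A : Type*} [Fintype X] [Fintype Θ] [Fintype A] [DecidableEq Θ]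

/-- The set of credible generators. -/
def credibleGenerators (p0 : X → ℝ) (vU : X → Θ → A → ℝ) : Set ((Θ → A) → X → ℝ) :=
  {π | IsGenerator12 π ∧ IsCredible12 p0 vU π}

lemma barvD12_add_smul (p0 : X → ℝ) (bD : X → Θ → ℝ) (vD : X → Θ → A → ℝ)
    (π π' : (Θ → A) → X → ℝ) (a b : ℝ) :
    barvD12 p0 bD vD (a • π + b • π') = a * barvD12 p0 bD vD π + b * barvD12 p0 bD vD π' := by
  simp only [barvD12, Finset.mul_sum, ← Finset.sum_add_distrib, Pi.add_apply, Pi.smul_apply,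
    smul_eq_mul]
  refine Finset.sum_congr rfl fun x _ => Finset.sum_congr rfl fun s _ =>
    Finset.sum_congr rfl fun θ _ => ?_
  ring

lemma continuous_barvD12 (p0 : X → ℝ) (bD : X → Θ → ℝ) (vD : X → Θ → A → ℝ) :
    Continuous (barvD12 p0 bD vD) := by
  unfold barvD12
  fun_prop

lemma convex_credibleGenerators (p0 : X → ℝ) (vU : X → Θ → A → ℝ) :
    Convex ℝ (credibleGenerators p0 vU) := by
  rintro π ⟨⟨hπ, hπ1⟩, hπc⟩ π' ⟨⟨hπ', hπ1'⟩, hπc'⟩ a b ha hb hab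
  refine ⟨⟨fun s x => ?_, fun x => ?_⟩, fun s θ a' => ?_⟩
  · exact add_nonneg (mul_nonneg ha (hπ s x)) (mul_nonneg hb (hπ' s x))
  · simp [Finset.sum_add_distrib, ← Finset.mul_sum, hπ1, hπ1', hab]
  · have h := add_nonneg (mul_nonneg ha (hπc s θ a')) (mul_nonneg hb (hπc' s θ a'))
    rw [Finset.mul_sum, Finset.mul_sum, ← Finset.sum_add_distrib] at h
    refine h.trans_eq (Finset.sum_congr rfl fun x _ => ?_)
    simp only [Pi.add_apply, Pi.smul_apply, smul_eq_mul]
    ring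

lemma isCompact_credibleGenerators (p0 : X → ℝ) (vU : X → Θ → A → ℝ) :
    IsCompact (credibleGenerators p0 vU) := by
  refine (isCompact_Icc (a := (0 : (Θ → A) → X → ℝ)) (b := 1)).of_isClosed_subset ?_ ?_
  · simp only [credibleGenerators, IsGenerator12, IsCredible12, Set.ofPred_and, Set.ofPred_forall]
    refine ((isClosed_iInter fun s => isClosed_iInter fun x => ?_).inter
      (isClosed_iInter fun x => ?_)).inter
      (isClosed_iInter fun s => isClosed_iInter fun θ => isClosed_iInter fun a => ?_)
    · exact isClosed_le continuous_const (by fun_prop)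
    · exact isClosed_eq (by fun_prop) continuous_const
    · exact isClosed_le continuous_const (by fun_prop)
  · rintro π ⟨⟨hπ, hπ1⟩, -⟩
    refine ⟨hπ, fun s x => ?_⟩
    rw [Pi.one_apply, Pi.one_apply, ← hπ1 x]
    exact Finset.single_le_sum (fun s _ => hπ s x) (Finset.mem_univ s)

lemma credibleGenerators_nonempty [Nonempty A] (p0 : X → ℝ) (vU : X → Θ → A → ℝ) :
    (credibleGenerators p0 vU).Nonempty := by
  classical
  choose s₀ hs₀ using fun θ => Finite.exists_max fun a => ∑ x, p0 x * vU x θ a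
  refine ⟨fun s _ => if s = s₀ then 1 else 0, ⟨fun s x => ?_, fun x => ?_⟩, fun s θ a => ?_⟩
  · dsimp only
    split_ifs <;> norm_num
  · simp
  · by_cases h : s = s₀
    · subst h
      simpa [mul_sub, Finset.sum_sub_distrib] using hs₀ θ a
    · simp [h]

lemma exists_isMaxOn_barvD12 [Nonempty A] (p0 : X → ℝ) (vU vD : X → Θ → A → ℝ)
    (bD : X → Θ → ℝ) :
    ∃ π ∈ credibleGenerators p0 vU, IsMaxOn (barvD12 p0 bD vD) (credibleGenerators p0 vU) π :=
  (isCompact_credibleGenerators p0 vU).exists_isMaxOn (credibleGenerators_nonempty p0 vU)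
    (continuous_barvD12 p0 bD vD).continuousOn

/-- The set of optimal credible generators. -/
def optimalGenerators (p0 : X → ℝ) (vU vD : X → Θ → A → ℝ) (bD : X → Θ → ℝ) :
    Set ((Θ → A) → X → ℝ) :=
  {π | IsGenerator12 π ∧ IsCredible12 p0 vU π ∧
    ∀ π', IsGenerator12 π' → IsCredible12 p0 vU π' →
      barvD12 p0 bD vD π' ≤ barvD12 p0 bD vD π}

lemma optimalGenerators_nonempty [Nonempty A] (p0 : X → ℝ) (vU vD : X → Θ → A → ℝ)
    (bD : X → Θ → ℝ) : (optimalGenerators p0 vU vD bD).Nonempty :=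
  let ⟨π, hπ, hmax⟩ := exists_isMaxOn_barvD12 p0 vU vD bD
  ⟨π, hπ.1, hπ.2, fun _ h h' => hmax ⟨h, h'⟩⟩

lemma convex_optimalGenerators (p0 : X → ℝ) (vU vD : X → Θ → A → ℝ) (bD : X → Θ → ℝ) :
    Convex ℝ (optimalGenerators p0 vU vD bD) := by
  rintro π ⟨hπ, hπc, hmax⟩ π' ⟨hπ', hπc', hmax'⟩ a b ha hb hab
  obtain ⟨hg, hc⟩ := convex_credibleGenerators p0 vU ⟨hπ, hπc⟩ ⟨hπ', hπc'⟩ ha hb hab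
  refine ⟨hg, hc, fun ρ hρ hρc => ?_⟩
  rw [barvD12_add_smul]
  calc barvD12 p0 bD vD ρ = a * barvD12 p0 bD vD ρ + b * barvD12 p0 bD vD ρ := by
        rw [← add_mul, hab, one_mul]
    _ ≤ _ := add_le_add (mul_le_mul_of_nonneg_left (hmax ρ hρ hρc) ha)
        (mul_le_mul_of_nonneg_left (hmax' ρ hρ hρc) hb)

/-- Reweighting the signals of a credible generator by nonnegative factors preserves
credibility. -/
lemma reweight_mem_credibleGenerators {p0 : X → ℝ} {vU : X → Θ → A → ℝ}
    {π : (Θ → A) → X → ℝ} (hπ : π ∈ credibleGenerators p0 vU) {k : (Θ → A) → ℝ}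
    (hk : ∀ s, 0 ≤ k s) (hsum : ∑ s, k s • π s = ∑ s, π s) :
    (fun s => k s • π s) ∈ credibleGenerators p0 vU := by
  refine ⟨⟨fun s x => mul_nonneg (hk s) (hπ.1.1 s x), fun x => ?_⟩, fun s θ a => ?_⟩
  · have h := congrFun hsum x
    rw [Finset.sum_apply, Finset.sum_apply, hπ.1.2 x] at h
    exact h
  · refine (mul_nonneg (hk s) (hπ.2 s θ a)).trans_eq ?_
    rw [Finset.mul_sum]
    refine Finset.sum_congr rfl fun x _ => ?_
    simp only [Pi.smul_apply, smul_eq_mul]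
    ring

/-- More signals in use than states yields a nontrivial linear relation among the signal
columns, which the defender weakly likes. -/
lemma exists_relation_of_card_lt (p0 : X → ℝ) (vD : X → Θ → A → ℝ) (bD : X → Θ → ℝ)
    {π : (Θ → A) → X → ℝ} (hcard : Fintype.card X < Set.ncard {s | π s ≠ 0}) :
    ∃ c : (Θ → A) → ℝ, ∑ s, c s • π s = 0 ∧ (∃ s, c s ≠ 0) ∧ (∀ s, π s = 0 → c s = 0) ∧
      0 ≤ barvD12 p0 bD vD (fun s => c s • π s) := by
  classical
  have hdep : ¬ LinearIndependent ℝ (fun s : {s | π s ≠ 0} => π s) := fun h => by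
    have := h.fintype_card_le_finrank
    rw [Module.finrank_fintype_fun_eq_card] at this
    rw [← Nat.card_coe_set_eq, Nat.card_eq_fintype_card] at hcard
    omega
  obtain ⟨g, hg, s₁, hs₁⟩ := Fintype.not_linearIndependent_iff.1 hdep
  let c : (Θ → A) → ℝ := fun s => if h : π s ≠ 0 then g ⟨s, h⟩ else 0
  have hc0 : ∀ s, π s = 0 → c s = 0 := fun s h => dif_neg (not_not.2 h)
  have hcs : ∀ s : {s | π s ≠ 0}, c s = g s := fun s => dif_pos s.2
  have hsum : ∑ s, c s • π s = 0 := by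
    rw [← hg, ← Finset.sum_subset (Finset.subset_univ {s | π s ≠ 0}.toFinset)
      fun s _ hs => by rw [hc0 s (by simpa using hs), zero_smul],
      Finset.sum_subtype _ (fun s => Set.mem_toFinset) fun s => c s • π s]
    exact Finset.sum_congr rfl fun s _ => by rw [hcs]
  have hne : c s₁ ≠ 0 := by rwa [hcs]
  rcases le_total 0 (barvD12 p0 bD vD fun s => c s • π s) with h | h
  · exact ⟨c, hsum, ⟨s₁, hne⟩, hc0, h⟩
  · refine ⟨-c, ?_, ⟨s₁, neg_ne_zero.2 hne⟩, fun s hs => neg_eq_zero.2 (hc0 s hs), ?_⟩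
    · simp [hsum]
    · have heq : (fun s => (-c) s • π s) = (-1 : ℝ) • (fun s => c s • π s) + (0 : ℝ) • π := by
        ext s x
        simp
      rw [heq, barvD12_add_smul]
      linarith

/-- An optimal generator using more signals than there are states can be modified to use
strictly fewer signals. -/
lemma exists_optimalGenerators_ncard_lt {p0 : X → ℝ} {vU vD : X → Θ → A → ℝ} {bD : X → Θ → ℝ}
    {π : (Θ → A) → X → ℝ} (hπ : π ∈ optimalGenerators p0 vU vD bD)
    (hcard : Fintype.card X < Set.ncard {s | π s ≠ 0}) :
    ∃ π' ∈ optimalGenerators p0 vU vD bD,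
      Set.ncard {s | π' s ≠ 0} < Set.ncard {s | π s ≠ 0} := by
  obtain ⟨c, hc, ⟨s₁, hs₁⟩, hsupp, hval⟩ := exists_relation_of_card_lt p0 vD bD hcard
  have : Nonempty (Θ → A) := ⟨s₁⟩
  obtain ⟨s₀, hmin⟩ := Finite.exists_min c
  have hs₀ : c s₀ < 0 := by
    by_contra! h0
    have hnn : ∀ s, 0 ≤ c s := fun s => h0.trans (hmin s)
    have hz := (Finset.sum_eq_zero_iff_of_nonneg (f := fun s => c s • π s)
      fun s _ x => mul_nonneg (hnn s) (hπ.1.1 s x)).1 hc s₁ (Finset.mem_univ _)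
    exact hs₁ ((smul_eq_zero.1 hz).elim id (hsupp s₁))
  have ht : 0 ≤ (-c s₀)⁻¹ := inv_nonneg.2 (neg_pos.2 hs₀).le
  have hinv : (-c s₀)⁻¹ * c s₀ = -1 := by rw [inv_neg, neg_mul, inv_mul_cancel₀ hs₀.ne]
  have heq : (fun s => (1 + (-c s₀)⁻¹ * c s) • π s) =
      (1 : ℝ) • π + (-c s₀)⁻¹ • fun s => c s • π s := by
    ext s x
    simp only [Pi.add_apply, Pi.smul_apply, smul_eq_mul]
    ring
  have hk : ∀ s, 0 ≤ 1 + (-c s₀)⁻¹ * c s := fun s => by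
    have := mul_le_mul_of_nonneg_left (hmin s) ht
    linarith
  have hmem := reweight_mem_credibleGenerators ⟨hπ.1, hπ.2.1⟩ hk (by
    simp only [add_smul, one_smul, mul_smul, Finset.sum_add_distrib, ← Finset.smul_sum, hc,
      smul_zero, add_zero])
  refine ⟨_, ⟨hmem.1, hmem.2, fun ρ hρ hρc => ?_⟩,
    Set.ncard_lt_ncard (Set.ssubset_iff_exists.2 ⟨fun s hs h => hs ?_, s₀, ?_, ?_⟩)⟩
  · rw [heq, barvD12_add_smul, one_mul]
    exact (hπ.2.2 ρ hρ hρc).trans (le_add_of_nonneg_right (mul_nonneg ht hval))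
  · rw [h, smul_zero]
  · exact fun h => hs₀.ne (hsupp s₀ h)
  · simp only [Set.mem_ofPred_eq, ne_eq, not_not, hinv, add_neg_cancel, zero_smul]

lemma exists_optimalGenerators_ncard_le [Nonempty A] (p0 : X → ℝ) (vU vD : X → Θ → A → ℝ)
    (bD : X → Θ → ℝ) :
    ∃ π ∈ optimalGenerators p0 vU vD bD, Set.ncard {s | π s ≠ 0} ≤ Fintype.card X := by
  obtain ⟨π, hπ, hmin⟩ := exists_minimalFor_of_wellFoundedLT (· ∈ optimalGenerators p0 vU vD bD)
    (fun π => Set.ncard {s | π s ≠ 0}) (optimalGenerators_nonempty p0 vU vD bD)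
  refine ⟨π, hπ, ?_⟩
  by_contra! h
  obtain ⟨π', hπ', hlt⟩ := exists_optimalGenerators_ncard_lt hπ h
  exact hlt.not_ge (hmin hπ' hlt.le)

end OptimalGenerators

/-- Proposition 5: (i) the supremum of the defender's expected
posterior utility over credible generators is attained; (ii) the set of optimal
credible generators is convex, hence a singleton or infinite; (iii) some optimal
credible generator uses at most `N = |X|` security policies in total. -/
theorem optimal_generator_attained_and_efficient
    {X Θ A : Type*} [Fintype X] [Fintype Θ] [Fintype A]
    [Nonempty X] [Nonempty Θ] [Nonempty A] [DecidableEq Θ]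
    (p0 : X → ℝ) (hp0 : p0 ∈ stdSimplex ℝ X) (hp0pos : ∀ x, 0 < p0 x)
    (vU vD : X → Θ → A → ℝ) (bD : X → Θ → ℝ)
    (hbD : ∀ x θ, 0 ≤ bD x θ) (hbDsum : ∀ x, ∑ θ, bD x θ = 1) :
    (∃ πstar : (Θ → A) → X → ℝ,
        IsGenerator12 πstar ∧ IsCredible12 p0 vU πstar ∧
        ∀ π : (Θ → A) → X → ℝ, IsGenerator12 π → IsCredible12 p0 vU π →
          barvD12 p0 bD vD π ≤ barvD12 p0 bD vD πstar) ∧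
    (Convex ℝ {π : (Θ → A) → X → ℝ |
        IsGenerator12 π ∧ IsCredible12 p0 vU π ∧
        ∀ π' : (Θ → A) → X → ℝ, IsGenerator12 π' → IsCredible12 p0 vU π' →
          barvD12 p0 bD vD π' ≤ barvD12 p0 bD vD π} ∧
      ({π : (Θ → A) → X → ℝ |
        IsGenerator12 π ∧ IsCredible12 p0 vU π ∧
        ∀ π' : (Θ → A) → X → ℝ, IsGenerator12 π' → IsCredible12 p0 vU π' →
          barvD12 p0 bD vD π' ≤ barvD12 p0 bD vD π}.Subsingleton ∨
       {π : (Θ → A) → X → ℝ |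
        IsGenerator12 π ∧ IsCredible12 p0 vU π ∧
        ∀ π' : (Θ → A) → X → ℝ, IsGenerator12 π' → IsCredible12 p0 vU π' →
          barvD12 p0 bD vD π' ≤ barvD12 p0 bD vD π}.Infinite)) ∧
    (∃ πstar : (Θ → A) → X → ℝ,
        IsGenerator12 πstar ∧ IsCredible12 p0 vU πstar ∧
        (∀ π : (Θ → A) → X → ℝ, IsGenerator12 π → IsCredible12 p0 vU π →
          barvD12 p0 bD vD π ≤ barvD12 p0 bD vD πstar) ∧
        Set.ncard {s : Θ → A | ∃ x, 0 < πstar s x} ≤ Fintype.card X) := by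
  refine ⟨optimalGenerators_nonempty p0 vU vD bD, ⟨convex_optimalGenerators p0 vU vD bD, ?_⟩, ?_⟩
  · exact (Set.subsingleton_or_nontrivial (optimalGenerators p0 vU vD bD)).imp_right
      (convex_optimalGenerators p0 vU vD bD).isPreconnected.infinite_of_nontrivial
  · obtain ⟨π, ⟨hg, hc, hmax⟩, hcard⟩ := exists_optimalGenerators_ncard_le p0 vU vD bD
    refine ⟨π, hg, hc, hmax, (Set.ncard_le_ncard ?_).trans hcard⟩
    rintro s ⟨x, hx⟩ h
    simp [h] at hx
end

section
/- Unmanageability under nonpositive alignment (Theorem 2(a)): assume b_D(θ|x) = b̂(θ) for all x and v̂_D(x,θ,a) = ρ·v̂_U(x,θ,a) + ρ^t(x,θ) with ρ ≤ 0, and fix a common prior p0 ∈ Δ(X). Then for every credible generator π, the defender's expected posterior utility satisfies bar v_D(π) ≤ ṽ_D(p0), where ṽ_D(p) = Σ_{θ∈Θ} b̂(θ) [ρ·max_{a∈A} Σ_{n=1}^N p_n v̂_U(x_n,θ,a) + Σ_n p_n ρ^t(x_n,θ)]; moreover the zero-information generator that assigns probability 1 (in every state) to a policy recommending to each type θ a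 maximizer of a ↦ Σ_n p0(x_n) v̂_U(x_n,θ,a) is credible and achieves bar v_D(π) = ṽ_D(p0). Hence the maximum trust margin is zero and the optimal generator contains zero information. -/
/-- Under linearly dependent utilities, the defender's expected posterior utility is an affine
function of the user's expected posterior utilities by type. -/
theorem expected_posterior_utility_eq
    {S X Θ A : Type*} [Fintype S] [Fintype X] [Fintype Θ]
    (p : X → ℝ) (vU vD : X → Θ → A → ℝ) (b : Θ → ℝ) (ρ : ℝ) (ρt : X → Θ → ℝ)
    (hdep : ∀ x θ a, vD x θ a = ρ * vU x θ a + ρt x θ) (act : S → Θ → A)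
    (π : S → X → ℝ) (hπ : ∀ x, ∑ s, π s x = 1) :
    ∑ x, p x * ∑ s, π s x * ∑ θ, b θ * vD x θ (act s θ)
      = ∑ θ, b θ * (ρ * ∑ s, ∑ x, p x * π s x * vU x θ (act s θ) + ∑ x, p x * ρt x θ) := by
  have key : ∀ θ, ρ * ∑ s, ∑ x, p x * π s x * vU x θ (act s θ) + ∑ x, p x * ρt x θ
      = ∑ x, ∑ s, p x * π s x * vD x θ (act s θ) := by
    intro θ
    rw [Finset.sum_comm, Finset.mul_sum, ← Finset.sum_add_distrib]
    refine Finset.sum_congr rfl fun x _ => ?_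
    calc _ = ρ * ∑ s, p x * π s x * vU x θ (act s θ) + p x * (∑ s, π s x) * ρt x θ := by
          rw [hπ, mul_one]
      _ = _ := by
          simp only [Finset.mul_sum, Finset.sum_mul, ← Finset.sum_add_distrib, hdep]
          exact Finset.sum_congr rfl fun s _ => by ring
  simp only [key]
  simp only [Finset.mul_sum]
  conv_rhs => rw [Finset.sum_comm]
  refine Finset.sum_congr rfl fun x _ => ?_
  conv_rhs => rw [Finset.sum_comm]
  exact Finset.sum_congr rfl fun s _ => Finset.sum_congr rfl fun θ _ => by ring

/-- A credible generator gives each user type at least the prior expected utility of any fixed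
action. -/
theorem prior_utility_le_of_credible
    {S X Θ A : Type*} [Fintype S] [Fintype X]
    (p : X → ℝ) (vU : X → Θ → A → ℝ) (act : S → Θ → A)
    (π : S → X → ℝ) (hπ : ∀ x, ∑ s, π s x = 1)
    (hIC : ∀ s θ a, 0 ≤ ∑ x, p x * π s x * (vU x θ (act s θ) - vU x θ a)) (θ : Θ) (a : A) :
    ∑ x, p x * vU x θ a ≤ ∑ s, ∑ x, p x * π s x * vU x θ (act s θ) := by
  calc ∑ x, p x * vU x θ a = ∑ x, p x * (∑ s, π s x) * vU x θ a := by simp [hπ]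
    _ = ∑ s, ∑ x, p x * π s x * vU x θ a := by
        simp only [Finset.mul_sum, Finset.sum_mul]
        exact Finset.sum_comm
    _ ≤ _ := by
        refine Finset.sum_le_sum fun s _ => sub_nonneg.mp ?_
        rw [← Finset.sum_sub_distrib]
        simpa only [mul_sub] using hIC s θ a


/-- Theorem 2(a): under state-independent type belief and
linearly dependent utilities with `ρ ≤ 0`, every credible generator yields
expected posterior utility at most the prior utility `ṽ_D(p0)`, and the
zero-information generator recommending prior-optimal actions is credible and
achieves exactly `ṽ_D(p0)`; hence the maximum trust margin is zero. -/
theorem unmanageable_under_nonpositive_alignment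
    {X Θ A : Type*} [Fintype X] [Fintype Θ] [Fintype A]
    [Nonempty X] [Nonempty Θ] [Nonempty A] [DecidableEq Θ] [DecidableEq A]
    (p0 : X → ℝ) (hp0 : p0 ∈ stdSimplex ℝ X)
    (vU vD : X → Θ → A → ℝ) (bhat : Θ → ℝ) (ρ : ℝ) (ρt : X → Θ → ℝ)
    (hbhat : ∀ θ, 0 ≤ bhat θ) (hbhatsum : ∑ θ, bhat θ = 1)
    (hdep : ∀ x θ a, vD x θ a = ρ * vU x θ a + ρt x θ) (hρ : ρ ≤ 0)
    (sstar : Θ → A)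
    (hsstar : ∀ θ a, ∑ x, p0 x * vU x θ a ≤ ∑ x, p0 x * vU x θ (sstar θ)) :
    (∀ π : (Θ → A) → X → ℝ,
      (∀ s x, 0 ≤ π s x) → (∀ x, ∑ s, π s x = 1) →
      (∀ (s : Θ → A) (θ : Θ) (a : A),
        0 ≤ ∑ x, p0 x * π s x * (vU x θ (s θ) - vU x θ a)) →
      ∑ x, p0 x * ∑ s, π s x * ∑ θ, bhat θ * vD x θ (s θ)
        ≤ ∑ θ, bhat θ *
            (ρ * Finset.univ.sup' Finset.univ_nonempty
                  (fun a => ∑ x, p0 x * vU x θ a)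
              + ∑ x, p0 x * ρt x θ)) ∧
    (∀ (s : Θ → A) (θ : Θ) (a : A),
      0 ≤ ∑ x, p0 x * (if s = sstar then (1 : ℝ) else 0) *
            (vU x θ (s θ) - vU x θ a)) ∧
    (∑ x, p0 x * ∑ s : Θ → A, (if s = sstar then (1 : ℝ) else 0) *
        ∑ θ, bhat θ * vD x θ (s θ))
      = ∑ θ, bhat θ *
          (ρ * Finset.univ.sup' Finset.univ_nonempty
                (fun a => ∑ x, p0 x * vU x θ a)
            + ∑ x, p0 x * ρt x θ) := by
  have hsup : ∀ θ, Finset.univ.sup' Finset.univ_nonempty (fun a => ∑ x, p0 x * vU x θ a)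
      = ∑ x, p0 x * vU x θ (sstar θ) := fun θ =>
    le_antisymm (Finset.sup'_le _ _ fun a _ => hsstar θ a)
      (Finset.le_sup' (fun a => ∑ x, p0 x * vU x θ a) (Finset.mem_univ (sstar θ)))
  simp only [hsup]
  refine ⟨fun π _ hπ hIC => ?_, fun s θ a => ?_, ?_⟩
  · rw [expected_posterior_utility_eq p0 vU vD bhat ρ ρt hdep (fun s => s) π hπ]
    refine Finset.sum_le_sum fun θ _ => mul_le_mul_of_nonneg_left ?_ (hbhat θ)
    gcongr ?_ + _
    exact mul_le_mul_of_nonpos_left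
      (prior_utility_le_of_credible p0 vU (fun s => s) π hπ hIC θ (sstar θ)) hρ
  · split_ifs with h
    · subst h
      simpa [mul_sub, Finset.sum_sub_distrib] using hsstar θ a
    · simp
  · rw [expected_posterior_utility_eq p0 vU vD bhat ρ ρt hdep (fun s => s)
      (fun s _ => if s = sstar then (1 : ℝ) else 0) (by simp)]
    refine Finset.sum_congr rfl fun θ _ => ?_
    rw [Finset.sum_comm]
    simp
end

section
/- Full-information optimality under positive alignment (Theorem 2(b), first part): assume b_D(θ|x) = b̂(θ) for all x and v̂_D(x,θ,a) = ρ·v̂_U(x,θ,a) + ρ^t(x,θ) with ρ > 0, and fix a common prior p0 ∈ Δ(X). Then for every credible generator π: ṽ_D(p0) ≤ bar v_D(π) ≤ Σ_{n=1}^N p0(x_n) Σ_{θ∈Θ} b̂(θ) [ρ·max_{a∈A} v̂_U(x_n,θ,a) + ρ^t(x_n,θ)]; i.e., the trust margin of every credible generator is nonnegative. Moreover the upper bound is attained by a credible full-information generator, namely one that in each state x_n assigns probability 1 to a policy recommending to each type θ a maximizer of a ↦ v̂_U(x_n,θ,a). -/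
/-- The defender's expected posterior utility, disaggregated by user type. -/
theorem expected_posterior_utility_eq_sum_types
    {X Θ A : Type*} [Fintype X] [Fintype Θ] [Fintype A] [DecidableEq Θ]
    (p0 : X → ℝ) (vU vD : X → Θ → A → ℝ) (bhat : Θ → ℝ) (ρ : ℝ) (ρt : X → Θ → ℝ)
    (hdep : ∀ x θ a, vD x θ a = ρ * vU x θ a + ρt x θ)
    (π : (Θ → A) → X → ℝ) (hsum : ∀ x, ∑ s, π s x = 1) :
    ∑ x, p0 x * ∑ s, π s x * ∑ θ, bhat θ * vD x θ (s θ)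
      = ∑ θ, bhat θ * (ρ * ∑ s, ∑ x, p0 x * π s x * vU x θ (s θ)
          + ∑ x, p0 x * ρt x θ) := by
  have hρt : ∀ θ, ∑ x, p0 x * ρt x θ = ∑ x, ∑ s, p0 x * π s x * ρt x θ := fun θ =>
    Finset.sum_congr rfl fun x _ => by
      rw [← Finset.sum_mul, ← Finset.mul_sum, hsum, mul_one]
  have hswap : ∀ θ, ∑ s, ∑ x, p0 x * π s x * vU x θ (s θ)
      = ∑ x, ∑ s, p0 x * π s x * vU x θ (s θ) := fun θ => Finset.sum_comm
  simp only [hρt, hswap, ← Finset.sum_add_distrib, Finset.mul_sum]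
  rw [Finset.sum_comm (s := (Finset.univ : Finset Θ))]
  refine Finset.sum_congr rfl fun x _ => ?_
  rw [Finset.sum_comm]
  refine Finset.sum_congr rfl fun θ _ => Finset.sum_congr rfl fun s _ => ?_
  rw [hdep]
  ring

/-- Theorem 2(b), first part: under state-independent type
belief and linearly dependent utilities with `ρ > 0`, every credible generator
has expected posterior utility between the prior utility `ṽ_D(p0)` and the
full-information value, and the full-information generator (revealing the
state and recommending state-optimal actions) is credible and attains the
upper bound. -/
theorem full_information_optimal_under_positive_alignment
    {X Θ A : Type*} [Fintype X] [Fintype Θ] [Fintype A]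
    [Nonempty X] [Nonempty Θ] [Nonempty A] [DecidableEq Θ] [DecidableEq A]
    (p0 : X → ℝ) (hp0 : p0 ∈ stdSimplex ℝ X)
    (vU vD : X → Θ → A → ℝ) (bhat : Θ → ℝ) (ρ : ℝ) (ρt : X → Θ → ℝ)
    (hbhat : ∀ θ, 0 ≤ bhat θ) (hbhatsum : ∑ θ, bhat θ = 1)
    (hdep : ∀ x θ a, vD x θ a = ρ * vU x θ a + ρt x θ) (hρ : 0 < ρ)
    (sfull : X → Θ → A)
    (hsfull : ∀ x θ a, vU x θ a ≤ vU x θ (sfull x θ)) :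
    (∀ π : (Θ → A) → X → ℝ,
      (∀ s x, 0 ≤ π s x) → (∀ x, ∑ s, π s x = 1) →
      (∀ (s : Θ → A) (θ : Θ) (a : A),
        0 ≤ ∑ x, p0 x * π s x * (vU x θ (s θ) - vU x θ a)) →
      (∑ θ, bhat θ *
          (ρ * Finset.univ.sup' Finset.univ_nonempty
                (fun a => ∑ x, p0 x * vU x θ a)
            + ∑ x, p0 x * ρt x θ))
        ≤ ∑ x, p0 x * ∑ s, π s x * ∑ θ, bhat θ * vD x θ (s θ) ∧
      ∑ x, p0 x * ∑ s, π s x * ∑ θ, bhat θ * vD x θ (s θ)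
        ≤ ∑ x, p0 x * ∑ θ, bhat θ *
            (ρ * Finset.univ.sup' Finset.univ_nonempty (fun a => vU x θ a)
              + ρt x θ)) ∧
    (∀ (s : Θ → A) (θ : Θ) (a : A),
      0 ≤ ∑ x, p0 x * (if s = sfull x then (1 : ℝ) else 0) *
            (vU x θ (s θ) - vU x θ a)) ∧
    (∑ x, p0 x * ∑ s : Θ → A, (if s = sfull x then (1 : ℝ) else 0) *
        ∑ θ, bhat θ * vD x θ (s θ))
      = ∑ x, p0 x * ∑ θ, bhat θ *
          (ρ * Finset.univ.sup' Finset.univ_nonempty (fun a => vU x θ a)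
            + ρt x θ) := by
  have hp0 := hp0.1
  have hmax : ∀ x θ, Finset.univ.sup' Finset.univ_nonempty (fun a => vU x θ a)
      = vU x θ (sfull x θ) := fun x θ =>
    le_antisymm (Finset.sup'_le _ _ fun a _ => hsfull x θ a)
      (Finset.le_sup' (fun a => vU x θ a) (Finset.mem_univ _))
  simp only [hmax]
  refine ⟨fun π hπ hsum hIC => ⟨?_, ?_⟩, fun s θ a => ?_, ?_⟩
  · rw [expected_posterior_utility_eq_sum_types p0 vU vD bhat ρ ρt hdep π hsum]
    gcongr with θ
    · exact hbhat θ
    refine Finset.sup'_le _ _ fun a _ => ?_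
    calc ∑ x, p0 x * vU x θ a = ∑ s, ∑ x, p0 x * π s x * vU x θ a := by
          rw [Finset.sum_comm]
          refine Finset.sum_congr rfl fun x _ => ?_
          rw [← Finset.sum_mul, ← Finset.mul_sum, hsum, mul_one]
      _ ≤ _ := Finset.sum_le_sum fun s _ => by
          simpa only [mul_sub, Finset.sum_sub_distrib, sub_nonneg] using hIC s θ a
  · refine Finset.sum_le_sum fun x _ => mul_le_mul_of_nonneg_left ?_ (hp0 x)
    calc _ ≤ ∑ s, π s x * ∑ θ, bhat θ * (ρ * vU x θ (sfull x θ) + ρt x θ) := by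
          gcongr with s _ θ
          · exact hπ s x
          · exact hbhat θ
          · rw [hdep]
            gcongr
            exact hsfull x θ _
      _ = _ := by rw [← Finset.sum_mul, hsum, one_mul]
  · refine Finset.sum_nonneg fun x _ => ?_
    split_ifs with h
    · subst h
      exact mul_nonneg (mul_nonneg (hp0 x) zero_le_one) (sub_nonneg.2 (hsfull x θ a))
    · simp
  · simp [hdep]
end

section
/- Strictly positive trust margin (Theorem 2(b), second part): assume v̂_D(x,θ,a) = ρ·v̂_U(x,θ,a) + ρ^t(x,θ) with ρ > 0 and state-independent type belief b̂ on Θ. Suppose the common prior p0 is an interior point of the simplex (p0(x_n) > 0 for every n) and there exists a type θ0 with b̂(θ0) > 0 under which no action dominates, i.e., no single action a ∈ A satisfies v̂_U(x,θ0,a) ≥ v̂_U(x,θ0,a') for all x ∈ X and a' ∈ A. Then the full-information value strictly exceeds the prior utility: Σ_{n=1}^N p0(x_n) Σ_{θ∈Θ} b̂(θ) [ρ·max_{a∈A} v̂_U(x_n,θ,a) + ρ^t(x_n,θ)] > ṽ_D(p0). -/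
/-- The maximum of an average is at most the average of the maxima. -/
theorem sup'_sum_mul_le_sum_mul_sup' {X A : Type*} [Fintype X] [Fintype A] [Nonempty A]
    {p : X → ℝ} (hp : ∀ x, 0 ≤ p x) (v : X → A → ℝ) :
    Finset.univ.sup' Finset.univ_nonempty (fun a => ∑ x, p x * v x a)
      ≤ ∑ x, p x * Finset.univ.sup' Finset.univ_nonempty (fun a => v x a) :=
  Finset.sup'_le _ _ fun a _ => Finset.sum_le_sum fun x _ =>
    mul_le_mul_of_nonneg_left (Finset.le_sup' (fun a => v x a) (Finset.mem_univ a)) (hp x)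

/-- With positive weights and no uniformly maximal action, the maximum of the average is
strictly less than the average of the maxima. -/
theorem sup'_sum_mul_lt_sum_mul_sup' {X A : Type*} [Fintype X] [Fintype A] [Nonempty A]
    {p : X → ℝ} (hp : ∀ x, 0 < p x) {v : X → A → ℝ}
    (hv : ¬ ∃ a : A, ∀ (x : X) (a' : A), v x a' ≤ v x a) :
    Finset.univ.sup' Finset.univ_nonempty (fun a => ∑ x, p x * v x a)
      < ∑ x, p x * Finset.univ.sup' Finset.univ_nonempty (fun a => v x a) := by
  refine (Finset.sup'_lt_iff _).2 fun a _ => ?_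
  push Not at hv
  obtain ⟨x, a', hx⟩ := hv a
  refine Finset.sum_lt_sum (fun y _ => mul_le_mul_of_nonneg_left
    (Finset.le_sup' (fun a => v y a) (Finset.mem_univ a)) (hp y).le) ⟨x, Finset.mem_univ x, ?_⟩
  exact mul_lt_mul_of_pos_left
    (hx.trans_le (Finset.le_sup' (fun a => v x a) (Finset.mem_univ a'))) (hp x)

/-- Theorem 2(b), second part: with `ρ > 0`, an interior common
prior, and a type of positive weight under which no action dominates, the
full-information value strictly exceeds the defender's prior utility. -/
theorem strictly_positive_trust_margin
    {X Θ A : Type*} [Fintype X] [Fintype Θ] [Fintype A]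
    [Nonempty X] [Nonempty Θ] [Nonempty A]
    (p0 : X → ℝ) (hp0 : p0 ∈ stdSimplex ℝ X) (hp0pos : ∀ x, 0 < p0 x)
    (vU vD : X → Θ → A → ℝ) (bhat : Θ → ℝ) (ρ : ℝ) (ρt : X → Θ → ℝ)
    (hbhat : ∀ θ, 0 ≤ bhat θ) (hbhatsum : ∑ θ, bhat θ = 1)
    (hdep : ∀ x θ a, vD x θ a = ρ * vU x θ a + ρt x θ) (hρ : 0 < ρ)
    (θ0 : Θ) (hθ0 : 0 < bhat θ0)
    (hnodom : ¬ ∃ a : A, ∀ (x : X) (a' : A), vU x θ0 a' ≤ vU x θ0 a) :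
    (∑ θ, bhat θ *
        (ρ * Finset.univ.sup' Finset.univ_nonempty
              (fun a => ∑ x, p0 x * vU x θ a)
          + ∑ x, p0 x * ρt x θ))
      < ∑ x, p0 x * ∑ θ, bhat θ *
          (ρ * Finset.univ.sup' Finset.univ_nonempty (fun a => vU x θ a)
            + ρt x θ) := by
  have hswap : (∑ x, p0 x * ∑ θ, bhat θ *
      (ρ * Finset.univ.sup' Finset.univ_nonempty (fun a => vU x θ a) + ρt x θ))
      = ∑ θ, bhat θ * (ρ * (∑ x, p0 x *
          Finset.univ.sup' Finset.univ_nonempty (fun a => vU x θ a))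
        + ∑ x, p0 x * ρt x θ) := by
    simp only [Finset.mul_sum, ← Finset.sum_add_distrib]
    rw [Finset.sum_comm]
    refine Finset.sum_congr rfl fun θ _ => Finset.sum_congr rfl fun x _ => ?_
    ring
  rw [hswap]
  refine Finset.sum_lt_sum (fun θ _ => ?_) ⟨θ0, Finset.mem_univ θ0, ?_⟩
  · have h := sup'_sum_mul_le_sum_mul_sup' (fun x => (hp0pos x).le) (fun x a => vU x θ a)
    exact mul_le_mul_of_nonneg_left
      (add_le_add_left (mul_le_mul_of_nonneg_left h hρ.le) _) (hbhat θ)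
  · have h := sup'_sum_mul_lt_sum_mul_sup' (v := fun x a => vU x θ0 a) hp0pos hnodom
    exact mul_lt_mul_of_pos_left
      (add_lt_add_left (mul_lt_mul_of_pos_left h hρ) _) hθ0
end

section
/- Existence of an optimal distorted initial belief (Proposition 6): the function F : Δ(X) → ℝ, F(p) = max{L_σ(p) : σ : Θ → A incentive-compatible at p}, attains its maximum over Δ(X); moreover a maximizer can be chosen to be an extreme point of the convex polytope C_σ for some profile σ, where C_σ = {p ∈ Δ(X) : σ is incentive-compatible at p}. -/
/-- A continuous linear functional on a nonempty compact set attains its maximum at an extreme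
point of the set. -/
theorem IsCompact.exists_mem_extremePoints_forall_le {E : Type*} [AddCommGroup E] [Module ℝ E]
    [TopologicalSpace E] [T2Space E] [IsTopologicalAddGroup E] [ContinuousSMul ℝ E]
    [LocallyConvexSpace ℝ E] {s : Set E} (hs : IsCompact s) (hne : s.Nonempty)
    (l : E →L[ℝ] ℝ) : ∃ x ∈ s.extremePoints ℝ, ∀ y ∈ s, l y ≤ l x := by
  have hexp : IsExposed ℝ s (l.toExposed s) :=
    ContinuousLinearMap.toExposed.isExposed
  obtain ⟨z, hz, hmax⟩ := hs.exists_isMaxOn hne l.continuous.continuousOn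
  have hcompact : IsCompact (l.toExposed s) := hexp.isCompact hs
  obtain ⟨x, hx⟩ := hcompact.extremePoints_nonempty ⟨z, hz, hmax⟩
  exact ⟨x, hexp.isExtreme.extremePoints_subset_extremePoints hx, hx.1.2⟩

/-- Among finitely many compact sets, not all empty, each with its own continuous linear
functional, the overall maximum is attained at an extreme point of one of the sets. -/
theorem exists_mem_extremePoints_forall_le_of_finite {ι E : Type*} [Finite ι] [AddCommGroup E]
    [Module ℝ E] [TopologicalSpace E] [T2Space E] [IsTopologicalAddGroup E] [ContinuousSMul ℝ E]
    [LocallyConvexSpace ℝ E] {s : ι → Set E} (hs : ∀ i, IsCompact (s i))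
    (hne : ∃ i, (s i).Nonempty) (l : ι → E →L[ℝ] ℝ) :
    ∃ i, ∃ x ∈ (s i).extremePoints ℝ, ∀ j, ∀ y ∈ s j, l j y ≤ l i x := by
  have hmax (i : {i // (s i).Nonempty}) :=
    (hs i).exists_mem_extremePoints_forall_le i.2 (l i)
  choose x hx hle using hmax
  have : Nonempty {i // (s i).Nonempty} := nonempty_subtype.2 hne
  obtain ⟨i, hi⟩ := Finite.exists_max fun i : {i // (s i).Nonempty} => l i (x i)
  exact ⟨i, x i, hx i, fun j y hy => (hle ⟨j, y, hy⟩ y hy).trans (hi ⟨j, y, hy⟩)⟩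


/-- Proposition 6: the defender's (defender-preferred) prior
utility `F(p) = max{L_σ(p) : σ incentive-compatible at p}` attains its maximum
over the simplex, and a maximizer can be chosen to be an extreme point of the
convex polytope `C_σ` for some profile `σ` that realizes the maximum. -/
theorem optimal_distorted_initial_belief_exists
    {X Θ A : Type*} [Fintype X] [Fintype Θ] [Fintype A]
    [Nonempty X] [Nonempty Θ] [Nonempty A]
    (vU vD : X → Θ → A → ℝ) (bD : X → Θ → ℝ)
    (hbD : ∀ x θ, 0 ≤ bD x θ) (hbDsum : ∀ x, ∑ θ, bD x θ = 1) :
    ∃ (pg : X → ℝ) (σ : Θ → A),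
      pg ∈ stdSimplex ℝ X ∧
      (∀ (θ : Θ) (a : A), ∑ x, pg x * vU x θ a ≤ ∑ x, pg x * vU x θ (σ θ)) ∧
      pg ∈ Set.extremePoints ℝ {p : X → ℝ | p ∈ stdSimplex ℝ X ∧
        ∀ (θ : Θ) (a : A), ∑ x, p x * vU x θ a ≤ ∑ x, p x * vU x θ (σ θ)} ∧
      (∀ p ∈ stdSimplex ℝ X, ∀ σ' : Θ → A,
        (∀ (θ : Θ) (a : A), ∑ x, p x * vU x θ a ≤ ∑ x, p x * vU x θ (σ' θ)) →
        ∑ x, p x * ∑ θ, bD x θ * vD x θ (σ' θ)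
          ≤ ∑ x, pg x * ∑ θ, bD x θ * vD x θ (σ θ)) := by
  let C (σ : Θ → A) : Set (X → ℝ) := {p | p ∈ stdSimplex ℝ X ∧
    ∀ (θ : Θ) (a : A), ∑ x, p x * vU x θ a ≤ ∑ x, p x * vU x θ (σ θ)}
  let L (σ : Θ → A) : (X → ℝ) →L[ℝ] ℝ :=
    ∑ x, (∑ θ, bD x θ * vD x θ (σ θ)) • ContinuousLinearMap.proj x
  have hL (σ : Θ → A) (p : X → ℝ) : L σ p = ∑ x, p x * ∑ θ, bD x θ * vD x θ (σ θ) := by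
    simp [L, mul_comm]
  have hC (σ : Θ → A) : IsCompact (C σ) := by
    refine (isCompact_stdSimplex ℝ X).inter_right
      (t := {p | ∀ (θ : Θ) (a : A), ∑ x, p x * vU x θ a ≤ ∑ x, p x * vU x θ (σ θ)}) ?_
    simp only [Set.ofPred_forall]
    exact isClosed_iInter fun θ => isClosed_iInter fun a =>
      isClosed_le (by fun_prop) (by fun_prop)
  have hne : ∃ σ, (C σ).Nonempty := by
    classical
    obtain ⟨x₀⟩ := ‹Nonempty X›
    let p : X → ℝ := Pi.single x₀ 1
    choose σ hσ using fun θ => Finite.exists_max fun a => ∑ x, p x * vU x θ a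
    exact ⟨σ, p, single_mem_stdSimplex ℝ x₀, hσ⟩
  obtain ⟨σ, p, hp, hmax⟩ := exists_mem_extremePoints_forall_le_of_finite hC hne L
  refine ⟨p, σ, hp.1.1, hp.1.2, hp, fun q hq σ' hσ' => ?_⟩
  simpa only [hL] using hmax σ' q ⟨hq, hσ'⟩
end

section
/- Equivalence principle for the joint design of generator and overt manipulator (Theorem 3): the supremum of the defender's expected posterior utility over all common priors p0 ∈ Δ(X) and all generators π that are credible at p0 equals the supremum over p0 ∈ Δ(X) of the defender's prior utility F(p0): sup_{p0 ∈ Δ(X)} sup_{π credible at p0} bar v_D(π, p0) = sup_{p ∈ Δ(X)} F(p). In particular, the optimal value of the joint design is achieved using a zero-information generator combined with an optimally manipulated initial belief. -/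
/-- A weighted average is attained or exceeded on a part of positive weight. -/
theorem exists_pos_weight_mul_le {ι : Type*} [Fintype ι] (m u : ι → ℝ) (hm : ∀ i, 0 ≤ m i)
    (hsum : ∑ i, m i = 1) (hu : ∀ i, m i = 0 → u i = 0) :
    ∃ i, 0 < m i ∧ m i * ∑ j, u j ≤ u i := by
  by_contra! h
  obtain ⟨i, -, hi⟩ : ∃ i ∈ Finset.univ, (0 : ℝ) < m i := by
    apply Finset.exists_lt_of_sum_lt
    simp [hsum]
  have hlt : ∑ i, u i < ∑ i, m i * ∑ j, u j := by
    refine Finset.sum_lt_sum (fun j _ => ?_) ⟨i, Finset.mem_univ i, h i hi⟩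
    rcases (hm j).eq_or_lt with h0 | h0
    · simp [hu j h0.symm, ← h0]
    · exact (h j h0).le
  rw [← Finset.sum_mul, hsum, one_mul] at hlt
  exact hlt.false

/-- For every expected utility of a signal with likelihoods `π`, some signal has a posterior
belief at which its conditional utility is at least as large. -/
theorem exists_posterior_le {X S : Type*} [Fintype X] [Fintype S] {p : X → ℝ}
    (hp : p ∈ stdSimplex ℝ X) (π : S → X → ℝ) (hπ : ∀ s x, 0 ≤ π s x)
    (hπsum : ∀ x, ∑ s, π s x = 1) (w : X → S → ℝ) :
    ∃ s, ∃ c : ℝ, 0 ≤ c ∧ (fun x => c * (p x * π s x)) ∈ stdSimplex ℝ X ∧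
      ∑ x, p x * ∑ s, π s x * w x s ≤ ∑ x, c * (p x * π s x) * w x s := by
  have hnn : ∀ s x, 0 ≤ p x * π s x := fun s x => mul_nonneg (hp.1 x) (hπ s x)
  have hsum : ∑ s, ∑ x, p x * π s x = 1 := by
    rw [Finset.sum_comm]
    simp [← Finset.mul_sum, hπsum, hp.2]
  obtain ⟨s, hs, hle⟩ := exists_pos_weight_mul_le (fun s => ∑ x, p x * π s x)
    (fun s => ∑ x, p x * π s x * w x s) (fun s => Finset.sum_nonneg fun x _ => hnn s x) hsum
    (fun s h0 => by
      rw [Finset.sum_eq_zero_iff_of_nonneg fun x _ => hnn s x] at h0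
      exact Finset.sum_eq_zero fun x hx => by rw [h0 x hx, zero_mul])
  refine ⟨s, (∑ x, p x * π s x)⁻¹, (inv_pos.2 hs).le,
    ⟨fun x => mul_nonneg (inv_pos.2 hs).le (hnn s x), ?_⟩, ?_⟩
  · rw [← Finset.mul_sum, inv_mul_cancel₀ hs.ne']
  · have hv : ∑ x, p x * ∑ s, π s x * w x s = ∑ s, ∑ x, p x * π s x * w x s := by
      rw [Finset.sum_comm]
      simp [Finset.mul_sum, mul_assoc]
    simp only [mul_assoc _ (p _ * π s _)]
    rw [← Finset.mul_sum, hv, le_inv_mul_iff₀ hs]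
    exact hle


/-- Theorem 3, equivalence principle: the supremum of the
defender's expected posterior utility over all common priors and all
generators credible at that prior equals the supremum over beliefs of the
defender's prior utility `F`; i.e., the joint design of generator and overt
manipulator is equivalent to the single design of the manipulator with a
zero-information generator. -/
theorem equivalence_principle_generator_manipulator
    {X Θ A : Type*} [Fintype X] [Fintype Θ] [Fintype A]
    [Nonempty X] [Nonempty Θ] [Nonempty A] [DecidableEq Θ]
    (vU vD : X → Θ → A → ℝ) (bD : X → Θ → ℝ)
    (hbD : ∀ x θ, 0 ≤ bD x θ) (hbDsum : ∀ x, ∑ θ, bD x θ = 1) :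
    sSup {v : ℝ | ∃ p0 ∈ stdSimplex ℝ X, ∃ π : (Θ → A) → X → ℝ,
        (∀ s x, 0 ≤ π s x) ∧ (∀ x, ∑ s, π s x = 1) ∧
        (∀ (s : Θ → A) (θ : Θ) (a : A),
          0 ≤ ∑ x, p0 x * π s x * (vU x θ (s θ) - vU x θ a)) ∧
        v = ∑ x, p0 x * ∑ s, π s x * ∑ θ, bD x θ * vD x θ (s θ)}
      = sSup {v : ℝ | ∃ p ∈ stdSimplex ℝ X, ∃ σ : Θ → A,
          (∀ (θ : Θ) (a : A), ∑ x, p x * vU x θ a ≤ ∑ x, p x * vU x θ (σ θ)) ∧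
          (∀ σ' : Θ → A,
            (∀ (θ : Θ) (a : A), ∑ x, p x * vU x θ a ≤ ∑ x, p x * vU x θ (σ' θ)) →
            ∑ x, p x * ∑ θ, bD x θ * vD x θ (σ' θ)
              ≤ ∑ x, p x * ∑ θ, bD x θ * vD x θ (σ θ)) ∧
          v = ∑ x, p x * ∑ θ, bD x θ * vD x θ (σ θ)} := by
  apply csSup_eq_csSup_of_forall_exists_le
  · rintro v ⟨p, hp, π, hπ, hπsum, hcred, rfl⟩
    obtain ⟨s, c, hc, hq, hle⟩ := exists_posterior_le hp π hπ hπsum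
      fun x s => ∑ θ, bD x θ * vD x θ (s θ)
    have hs : ∀ (θ : Θ) (a : A), ∑ x, c * (p x * π s x) * vU x θ a
        ≤ ∑ x, c * (p x * π s x) * vU x θ (s θ) := by
      intro θ a
      have h := mul_nonneg hc (hcred s θ a)
      rw [← sub_nonneg, ← Finset.sum_sub_distrib]
      simpa only [Finset.mul_sum, mul_sub, mul_assoc] using h
    obtain ⟨σ, hσ, hmax⟩ := Set.exists_max_image
      {σ : Θ → A | ∀ (θ : Θ) (a : A), ∑ x, c * (p x * π s x) * vU x θ a
        ≤ ∑ x, c * (p x * π s x) * vU x θ (σ θ)}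
      (fun σ => ∑ x, c * (p x * π s x) * ∑ θ, bD x θ * vD x θ (σ θ))
      (Set.toFinite _) ⟨s, hs⟩
    exact ⟨_, ⟨_, hq, σ, hσ, hmax, rfl⟩, hle.trans (hmax s hs)⟩
  · rintro v ⟨p, hp, σ, hσ, -, rfl⟩
    classical
    refine ⟨_, ⟨p, hp, fun s _ => if s = σ then 1 else 0, ?_, ?_, ?_, rfl⟩, ?_⟩
    · intro s x
      dsimp only
      split_ifs <;> norm_num
    · simp
    · intro s θ a
      by_cases h : s = σ
      · subst h
        simpa [mul_sub] using hσ θ a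
      · simp [h]
    · simp
end

section
/- Mutually exclusive separating policies in the honeypot game (Corollary 1): assume r_U > 0, φ^g_U < 0, φ^N_U > 0 and φ^H_U < 0. Then there do not exist posterior beliefs q, q' ∈ [0,1] such that u^g(q) > 0 > u^b(q) and u^g(q') < 0 < u^b(q'); i.e., the security policy under which the selfish insider strictly prefers to access while the adversarial insider strictly prefers not to, and the security policy under which the adversarial insider strictly prefers to access while the selfish insider strictly prefers not to, cannot both be enforceable at any posterior beliefs. -/
/-- Corollary 1: in the honeypot game, the two separating
security policies are mutually exclusive: there are no posterior beliefs
`q, q' ∈ [0,1]` such that the selfish insider strictly prefers access while the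
adversarial one strictly prefers no access at `q`, and vice versa at `q'`. -/
theorem separating_policies_mutually_exclusive
    (rU φg φH φN φ0 : ℝ)
    (hrU : 0 < rU) (hφg : φg < 0) (hφN : 0 < φN) (hφH : φH < 0) :
    ¬ ∃ q ∈ Set.Icc (0 : ℝ) 1, ∃ q' ∈ Set.Icc (0 : ℝ) 1,
        (0 < rU * (q * φg + (1 - q) - φ0) ∧
          rU * (q * φH + (1 - q) * φN - φ0) < 0) ∧
        (rU * (q' * φg + (1 - q') - φ0) < 0 ∧
          0 < rU * (q' * φH + (1 - q') * φN - φ0)) := by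
  rintro ⟨q, -, q', -, ⟨hg, hb⟩, hg', hb'⟩
  rw [mul_pos_iff_of_pos_left hrU] at hg hb'
  replace hb := neg_of_mul_neg_right hb hrU.le
  replace hg' := neg_of_mul_neg_right hg' hrU.le
  have hlt : q < q' := by
    by_contra! h
    nlinarith [mul_nonneg (sub_nonneg.2 h) (by linarith : 0 ≤ 1 - φg)]
  nlinarith [mul_pos (sub_pos.2 hlt) (by linarith : 0 < φN - φH)]
end
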